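/- If h : ℝ → ℝ is differentiable with bounded derivative, then the solution y of the Stein equation satisfies sup_{x∈ℝ} |x·y'(x)| ≤ 3(1−ψ)⁻¹·‖h'‖_∞. -/

import Mathlib

open MeasureTheory ProbabilityTheory Real Set

noncomputable section

/-- `h̄_ψ = E h(N)` for `N ~ N(0, (1-ψ)⁻¹)`. -/
def gaussMean (ψ : ℝ) (h : ℝ → ℝ) : ℝ :=
  ∫ x, h x ∂(gaussianReal 0 (Real.toNNReal (1 - ψ)⁻¹))

/-- The bounded solution `y` of the Stein equation
`y'(x) - (1-ψ) x y(x) = h(x) - h̄_ψ`, given explicitly by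
`y(x) = -e^{(1-ψ)x²/2} ∫_x^∞ e^{-(1-ψ)t²/2} (h(t) - h̄_ψ) dt`. -/
def steinSol (ψ : ℝ) (h : ℝ → ℝ) (x : ℝ) : ℝ :=
  - Real.exp ((1 - ψ) * x ^ 2 / 2) *
      ∫ t in Set.Ioi x, Real.exp (-((1 - ψ) * t ^ 2 / 2)) * (h t - gaussMean ψ h)

section GaussianTail

variable {a : ℝ}

lemma integrable_exp_neg_half (ha : 0 < a) :
    Integrable fun t : ℝ => exp (-(a * t ^ 2 / 2)) := by
  convert! integrable_exp_neg_mul_sq (half_pos ha) using 3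
  ring

lemma integrable_mul_exp_neg_half (ha : 0 < a) :
    Integrable fun t : ℝ => t * exp (-(a * t ^ 2 / 2)) := by
  convert! integrable_mul_exp_neg_mul_sq (half_pos ha) using 4
  ring

lemma hasDerivAt_exp_neg_half (a t : ℝ) :
    HasDerivAt (fun t : ℝ => exp (-(a * t ^ 2 / 2))) (-(a * t) * exp (-(a * t ^ 2 / 2))) t := by
  have h1 : HasDerivAt (fun t : ℝ => -(a * t ^ 2 / 2)) (-(a * t)) t := by
    convert! ((((hasDerivAt_id t).pow 2).const_mul a).div_const 2).neg using 1
    simp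
    ring
  convert! h1.exp using 1
  ring

/-- The first moment of the Gaussian weight on a half-line. -/
lemma integral_Ioi_mul_exp_neg_half (ha : 0 < a) (x : ℝ) :
    ∫ t in Ioi x, t * exp (-(a * t ^ 2 / 2)) = exp (-(a * x ^ 2 / 2)) / a := by
  have hint : Integrable fun t : ℝ => -(a * t) * exp (-(a * t ^ 2 / 2)) := by
    convert! (integrable_mul_exp_neg_half ha).const_mul (-a) using 2
    ring
  have h0 := tendsto_zero_of_hasDerivAt_of_integrableOn_Ioi (a := x)
    (fun t _ => hasDerivAt_exp_neg_half a t) hint.integrableOn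
    (integrable_exp_neg_half ha).integrableOn
  have h1 := integral_Ioi_of_hasDerivAt_of_tendsto' (a := x)
    (fun t _ => hasDerivAt_exp_neg_half a t) hint.integrableOn h0
  have h2 : ∫ t in Ioi x, -(a * t) * exp (-(a * t ^ 2 / 2))
      = -a * ∫ t in Ioi x, t * exp (-(a * t ^ 2 / 2)) := by
    rw [← integral_const_mul]
    congr 1
    ext t
    ring
  rw [h2] at h1
  rw [eq_div_iff ha.ne']
  linarith

/-- Lower bound on the Mills ratio of a centered Gaussian. -/
lemma exp_neg_half_le_mills (ha : 0 < a) (x : ℝ) :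
    x / (1 + a * x ^ 2) * exp (-(a * x ^ 2 / 2)) ≤ ∫ t in Ioi x, exp (-(a * t ^ 2 / 2)) := by
  set g : ℝ → ℝ := fun t => exp (-(a * t ^ 2 / 2)) with hg
  have hpos (t : ℝ) : 0 < 1 + a * t ^ 2 := by positivity
  have hderiv (t : ℝ) : HasDerivAt (fun t : ℝ => t / (1 + a * t ^ 2) * g t)
      ((2 / (1 + a * t ^ 2) ^ 2 - 1) * g t) t := by
    have h1 : HasDerivAt (fun t : ℝ => 1 + a * t ^ 2) (2 * a * t) t := by
      convert! (((hasDerivAt_id t).pow 2).const_mul a).const_add 1 using 1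
      simp
      ring
    convert! ((hasDerivAt_id t).div h1 (hpos t).ne').mul (hasDerivAt_exp_neg_half a t) using 1
    have := (hpos t).ne'
    simp only [hg, id, Pi.div_apply]
    field_simp
    ring
  have hgi : Integrable g := integrable_exp_neg_half ha
  have hcont : Continuous fun t : ℝ => 1 + a * t ^ 2 := by fun_prop
  have hint' : Integrable fun t => (2 / (1 + a * t ^ 2) ^ 2 - 1) * g t := by
    refine hgi.bdd_mul (c := 1) ?_ ?_
    · exact (((continuous_const.div (hcont.pow 2)
        fun t => (pow_pos (hpos t) 2).ne')).sub continuous_const).aestronglyMeasurable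
    · refine Filter.Eventually.of_forall fun t => ?_
      have h1 : 1 ≤ (1 + a * t ^ 2) ^ 2 := by
        have : 0 ≤ a * t ^ 2 := by positivity
        nlinarith
      have h2 : 2 / (1 + a * t ^ 2) ^ 2 ≤ 2 := div_le_self (by norm_num) h1
      have h3 : 0 ≤ 2 / (1 + a * t ^ 2) ^ 2 := by positivity
      rw [Real.norm_eq_abs, abs_le]
      constructor <;> linarith
  have hint : Integrable fun t => t / (1 + a * t ^ 2) * g t := by
    refine (integrable_mul_exp_neg_half ha).mono ?_ ?_
    · exact (continuous_iff_continuousAt.2 fun t => (hderiv t).continuousAt).aestronglyMeasurable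
    · refine Filter.Eventually.of_forall fun t => ?_
      rw [norm_mul, norm_mul, norm_div, Real.norm_of_nonneg (hpos t).le]
      gcongr
      exact div_le_self (norm_nonneg _) (by nlinarith [sq_nonneg t])
  have h0 := tendsto_zero_of_hasDerivAt_of_integrableOn_Ioi (a := x)
    (fun t _ => hderiv t) hint'.integrableOn hint.integrableOn
  have h1 := integral_Ioi_of_hasDerivAt_of_tendsto' (a := x)
    (fun t _ => hderiv t) hint'.integrableOn h0
  have h2 : ∫ t in Ioi x, -g t ≤ ∫ t in Ioi x, (2 / (1 + a * t ^ 2) ^ 2 - 1) * g t := by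
    refine integral_mono hgi.neg.integrableOn hint'.integrableOn fun t => ?_
    have h3 : 0 ≤ 2 / (1 + a * t ^ 2) ^ 2 := by positivity
    have h4 : 0 ≤ g t := (exp_pos _).le
    change -g t ≤ (2 / (1 + a * t ^ 2) ^ 2 - 1) * g t
    nlinarith [mul_nonneg h3 h4]
  rw [integral_neg] at h2
  linarith

end GaussianTail

section Lipschitz

variable {h : ℝ → ℝ} {C : ℝ}

lemma abs_sub_le_of_abs_deriv_le (hdiff : Differentiable ℝ h) (hC : ∀ x, |deriv h x| ≤ C)
    (x t : ℝ) : |h t - h x| ≤ C * |t - x| :=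
  convex_univ.norm_image_sub_le_of_norm_deriv_le (fun s _ => hdiff s) (fun s _ => hC s)
    (mem_univ x) (mem_univ t)

lemma integrable_exp_neg_half_mul_sub {a : ℝ} (ha : 0 < a) (hcont : Continuous h)
    (hlip : ∀ x t, |h t - h x| ≤ C * |t - x|) (m : ℝ) :
    Integrable fun t : ℝ => exp (-(a * t ^ 2 / 2)) * (h t - m) := by
  refine (((integrable_exp_neg_half ha).const_mul |h 0 - m|).add
    ((integrable_mul_exp_neg_half ha).norm.const_mul C)).mono' ?_ ?_
  · exact Continuous.aestronglyMeasurable (by fun_prop)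
  · refine Filter.Eventually.of_forall fun t => ?_
    have h1 : |h t - m| ≤ |h 0 - m| + C * |t| := by
      have := hlip 0 t
      rw [sub_zero] at this
      linarith [abs_sub_le (h t) (h 0) m]
    have h2 := exp_pos (-(a * t ^ 2 / 2))
    simp only [norm_mul, Real.norm_eq_abs, abs_of_pos h2, Pi.add_apply]
    nlinarith [mul_le_mul_of_nonneg_left h1 h2.le]

lemma integrable_gaussianReal_of_lipschitz (v : NNReal) (hcont : Continuous h)
    (hlip : ∀ x t, |h t - h x| ≤ C * |t - x|) : Integrable h (gaussianReal 0 v) := by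
  have hid : Integrable (fun t : ℝ => t) (gaussianReal 0 v) :=
    (memLp_id_gaussianReal' 1 (by simp)).integrable le_rfl
  refine ((integrable_const |h 0|).add (hid.norm.const_mul C)).mono'
    hcont.aestronglyMeasurable (Filter.Eventually.of_forall fun t => ?_)
  have h1 := hlip 0 t
  rw [sub_zero] at h1
  simp only [Real.norm_eq_abs, Pi.add_apply]
  linarith [abs_sub_abs_le_abs_sub (h t) (h 0)]

lemma integral_sub_sq_gaussianReal (v : NNReal) (x : ℝ) :
    Integrable (fun t : ℝ => (t - x) ^ 2) (gaussianReal 0 v) ∧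
      ∫ t, (t - x) ^ 2 ∂(gaussianReal 0 v) = x ^ 2 + v := by
  have hL2 : MemLp (fun t : ℝ => t) 2 (gaussianReal 0 v) := memLp_id_gaussianReal' 2 (by simp)
  have hid : Integrable (fun t : ℝ => t) (gaussianReal 0 v) := hL2.integrable (by norm_num)
  have hvar := variance_eq_sub hL2
  rw [variance_fun_id_gaussianReal, integral_id_gaussianReal] at hvar
  have hsq : ∫ t : ℝ, t ^ 2 ∂(gaussianReal 0 v) = v := by
    have : ∫ t : ℝ, t ^ 2 ∂(gaussianReal 0 v) =
      ∫ t : ℝ, ((fun t : ℝ => t) ^ 2) t ∂(gaussianReal 0 v) := rfl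
    rw [this]
    linarith
  have heq : (fun t : ℝ => (t - x) ^ 2) = fun t => t ^ 2 + ((-2 * x) * t + x ^ 2) := by
    ext t
    ring
  have hlin : Integrable (fun t : ℝ => (-2 * x) * t + x ^ 2) (gaussianReal 0 v) :=
    (hid.const_mul _).add (integrable_const _)
  rw [heq]
  refine ⟨hL2.integrable_sq.add hlin, ?_⟩
  rw [integral_add hL2.integrable_sq hlin, integral_add (hid.const_mul _) (integrable_const _),
    integral_const_mul, integral_id_gaussianReal, hsq]
  simp
  ring

lemma mul_abs_sub_gaussMean_le {ψ : ℝ} (hψ : ψ < 1) (hC : 0 ≤ C) (hcont : Continuous h)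
    (hlip : ∀ x t, |h t - h x| ≤ C * |t - x|) {x : ℝ} (hx : 0 ≤ x) :
    x * |h x - gaussMean ψ h| ≤ C * (x ^ 2 + 1 / (2 * (1 - ψ))) := by
  have ha : 0 < 1 - ψ := by linarith
  set v := Real.toNNReal (1 - ψ)⁻¹ with hv
  have hv' : (v : ℝ) = (1 - ψ)⁻¹ := Real.coe_toNNReal _ (inv_pos.2 ha).le
  have hi := integrable_gaussianReal_of_lipschitz v hcont hlip
  obtain ⟨hsqi, hsq⟩ := integral_sub_sq_gaussianReal v x
  have h1 : x * (gaussMean ψ h - h x) = ∫ t, x * (h t - h x) ∂(gaussianReal 0 v) := by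
    rw [integral_const_mul, integral_sub hi (integrable_const _)]
    simp [gaussMean, ← hv]
  have h2 : ‖∫ t, x * (h t - h x) ∂(gaussianReal 0 v)‖
      ≤ ∫ t, C / 2 * (x ^ 2 + (t - x) ^ 2) ∂(gaussianReal 0 v) := by
    refine norm_integral_le_of_norm_le (((integrable_const _).add hsqi).const_mul _)
      (Filter.Eventually.of_forall fun t => ?_)
    rw [norm_mul, Real.norm_eq_abs, Real.norm_eq_abs, abs_of_nonneg hx]
    have h3 := mul_le_mul_of_nonneg_left (hlip x t) hx
    have h4 := mul_nonneg hC (sq_nonneg (x - |t - x|))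
    have h5 := sq_abs (t - x)
    rw [← h5]
    nlinarith
  rw [← h1, integral_const_mul, integral_add (integrable_const _) hsqi, hsq, hv', norm_mul,
    Real.norm_of_nonneg hx, Real.norm_eq_abs, abs_sub_comm] at h2
  simp at h2
  calc _ ≤ _ := h2
    _ = _ := by
      field_simp
      ring

end Lipschitz

lemma integral_exp_neg_half_mul_sub_gaussMean {ψ : ℝ} (hψ : ψ < 1) {h : ℝ → ℝ}
    (hi : Integrable h (gaussianReal 0 (Real.toNNReal (1 - ψ)⁻¹))) :
    ∫ t, exp (-((1 - ψ) * t ^ 2 / 2)) * (h t - gaussMean ψ h) = 0 := by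
  have ha : 0 < 1 - ψ := by linarith
  set v := Real.toNNReal (1 - ψ)⁻¹ with hv
  have hv' : (v : ℝ) = (1 - ψ)⁻¹ := Real.coe_toNNReal _ (inv_pos.2 ha).le
  have hv0 : v ≠ 0 := by
    rw [← NNReal.coe_ne_zero, hv']
    exact (inv_pos.2 ha).ne'
  have h1 : ∫ t, (h t - gaussMean ψ h) ∂(gaussianReal 0 v) = 0 := by
    rw [integral_sub hi (integrable_const _)]
    simp [gaussMean, ← hv]
  rw [integral_gaussianReal_eq_integral_smul hv0] at h1
  have h2 (t : ℝ) : gaussianPDFReal 0 v t • (h t - gaussMean ψ h)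
      = (√(2 * π * v))⁻¹ * (exp (-((1 - ψ) * t ^ 2 / 2)) * (h t - gaussMean ψ h)) := by
    rw [gaussianPDFReal, hv', smul_eq_mul, mul_assoc]
    congr 3
    field_simp
    ring
  simp_rw [h2] at h1
  rw [integral_const_mul] at h1
  refine (mul_eq_zero.1 h1).resolve_left ?_
  have : 0 < (v : ℝ) := hv' ▸ inv_pos.2 ha
  positivity

lemma gaussMean_comp_neg (ψ : ℝ) (h : ℝ → ℝ) :
    gaussMean ψ (fun x => h (-x)) = gaussMean ψ h := by
  have h1 := (Homeomorph.neg ℝ).measurableEmbedding.integral_map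
    (μ := gaussianReal 0 (Real.toNNReal (1 - ψ)⁻¹)) h
  have h2 : ((gaussianReal 0 (Real.toNNReal (1 - ψ)⁻¹)).map (Homeomorph.neg ℝ))
      = gaussianReal 0 (Real.toNNReal (1 - ψ)⁻¹) := by
    simpa using gaussianReal_map_neg (μ := 0) (v := Real.toNNReal (1 - ψ)⁻¹)
  rw [h2] at h1
  exact h1.symm

section Stein

variable {ψ : ℝ} {h : ℝ → ℝ} {C : ℝ}

/-- Reflecting the test function reflects the solution of the Stein equation. -/
lemma steinSol_comp_neg (hψ : ψ < 1) (hcont : Continuous h)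
    (hlip : ∀ x t, |h t - h x| ≤ C * |t - x|) (x : ℝ) :
    steinSol ψ (fun x => h (-x)) x = -steinSol ψ h (-x) := by
  have ha : 0 < 1 - ψ := by linarith
  have hz := integral_exp_neg_half_mul_sub_gaussMean hψ
    (integrable_gaussianReal_of_lipschitz _ hcont hlip)
  have hi := integrable_exp_neg_half_mul_sub ha hcont hlip (gaussMean ψ h)
  have h1 := integral_comp_neg_Ioi x
    fun t : ℝ => exp (-((1 - ψ) * t ^ 2 / 2)) * (h t - gaussMean ψ h)
  have h2 := intervalIntegral.integral_Iic_add_Ioi (b := -x) hi.integrableOn hi.integrableOn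
  rw [hz, ← h1] at h2
  simp only [neg_sq] at h2
  simp only [steinSol, gaussMean_comp_neg, neg_sq]
  linear_combination (-exp ((1 - ψ) * x ^ 2 / 2)) * h2

/-- The function `steinSol ψ h` solves the Stein equation. -/
lemma hasDerivAt_steinSol (hψ : ψ < 1) (hcont : Continuous h)
    (hlip : ∀ x t, |h t - h x| ≤ C * |t - x|) (x : ℝ) :
    HasDerivAt (steinSol ψ h) ((1 - ψ) * x * steinSol ψ h x + (h x - gaussMean ψ h)) x := by
  have ha : 0 < 1 - ψ := by linarith
  set f : ℝ → ℝ := fun t => exp (-((1 - ψ) * t ^ 2 / 2)) * (h t - gaussMean ψ h) with hf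
  have hfc : Continuous f := by fun_prop
  have hi : Integrable f := integrable_exp_neg_half_mul_sub ha hcont hlip (gaussMean ψ h)
  have h1 : HasDerivAt (fun u => ∫ t in Ioi u, f t) (-f x) x := by
    have h2 : (fun u => ∫ t in Ioi u, f t) = fun u => (∫ t in Ioi 0, f t) - ∫ t in (0)..u, f t := by
      ext u
      rw [← intervalIntegral.integral_Ioi_sub_Ioi' hi.integrableOn hi.integrableOn]
      ring
    rw [h2]
    exact (intervalIntegral.integral_hasDerivAt_right (hfc.intervalIntegrable _ _)
      (hfc.stronglyMeasurableAtFilter _ _) hfc.continuousAt).const_sub _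
  have h3 : HasDerivAt (fun u : ℝ => -exp ((1 - ψ) * u ^ 2 / 2))
      (-((1 - ψ) * x * exp ((1 - ψ) * x ^ 2 / 2))) x := by
    convert! (hasDerivAt_exp_neg_half (-(1 - ψ)) x).neg using 1
    · ext u
      simp only [Pi.neg_apply]
      congr 2
      ring
    · rw [show -(-(1 - ψ) * x ^ 2 / 2) = (1 - ψ) * x ^ 2 / 2 by ring]
      ring
  convert! h3.mul h1 using 1
  have h4 : exp ((1 - ψ) * x ^ 2 / 2) * exp (-((1 - ψ) * x ^ 2 / 2)) = 1 := by
    rw [← exp_add, add_neg_cancel, exp_zero]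
  simp only [steinSol, hf]
  linear_combination (-(h x - gaussMean ψ h)) * h4

lemma abs_mul_deriv_steinSol_le (hψ : ψ < 1) (hC : 0 ≤ C) (hcont : Continuous h)
    (hlip : ∀ x t, |h t - h x| ≤ C * |t - x|) {x : ℝ} (hx : 0 ≤ x) :
    |x * deriv (steinSol ψ h) x| ≤ 3 / (1 - ψ) * C := by
  have ha : 0 < 1 - ψ := by linarith
  rw [(hasDerivAt_steinSol hψ hcont hlip x).deriv]
  have hmean := mul_abs_sub_gaussMean_le hψ hC hcont hlip hx
  have hmills := exp_neg_half_le_mills ha x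
  have hmom := integral_Ioi_mul_exp_neg_half ha x
  have hgi := integrable_exp_neg_half ha
  have hgi' := integrable_mul_exp_neg_half ha
  have hi := integrable_exp_neg_half_mul_sub ha hcont hlip (h x)
  have hsplit : ∫ t in Ioi x, exp (-((1 - ψ) * t ^ 2 / 2)) * (h t - gaussMean ψ h)
      = (∫ t in Ioi x, exp (-((1 - ψ) * t ^ 2 / 2)) * (h t - h x))
        + (h x - gaussMean ψ h) * ∫ t in Ioi x, exp (-((1 - ψ) * t ^ 2 / 2)) := by
    rw [← integral_const_mul, ← integral_add hi.integrableOn (hgi.const_mul _).integrableOn]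
    congr 1
    ext t
    ring
  have hbound : |∫ t in Ioi x, exp (-((1 - ψ) * t ^ 2 / 2)) * (h t - h x)|
      ≤ C * (exp (-((1 - ψ) * x ^ 2 / 2)) / (1 - ψ)
        - x * ∫ t in Ioi x, exp (-((1 - ψ) * t ^ 2 / 2))) := by
    rw [← Real.norm_eq_abs, ← hmom, ← integral_const_mul x, ← integral_sub hgi'.integrableOn
      (hgi.const_mul x).integrableOn, ← integral_const_mul]
    refine norm_integral_le_of_norm_le (((hgi'.sub (hgi.const_mul x)).const_mul C).integrableOn)
      ((ae_restrict_iff' measurableSet_Ioi).2 (Filter.Eventually.of_forall fun t ht => ?_))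
    have h1 := hlip x t
    have h2 := exp_pos (-((1 - ψ) * t ^ 2 / 2))
    rw [abs_of_pos (sub_pos.2 (mem_Ioi.1 ht))] at h1
    rw [norm_mul, Real.norm_of_nonneg h2.le, Real.norm_eq_abs]
    linarith [mul_le_mul_of_nonneg_left h1 h2.le]
  have hupper : x * ∫ t in Ioi x, exp (-((1 - ψ) * t ^ 2 / 2))
      ≤ exp (-((1 - ψ) * x ^ 2 / 2)) / (1 - ψ) := by
    rw [← hmom, ← integral_const_mul]
    refine setIntegral_mono_on (hgi.const_mul x).integrableOn hgi'.integrableOn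
      measurableSet_Ioi fun t ht => ?_
    gcongr
    exact le_of_lt ht
  have hE : exp ((1 - ψ) * x ^ 2 / 2) * exp (-((1 - ψ) * x ^ 2 / 2)) = 1 := by
    rw [← exp_add, add_neg_cancel, exp_zero]
  simp only [steinSol, hsplit]
  set a := 1 - ψ
  set J := ∫ t in Ioi x, exp (-(a * t ^ 2 / 2)) * (h t - h x)
  set M := ∫ t in Ioi x, exp (-(a * t ^ 2 / 2))
  set E := exp (a * x ^ 2 / 2)
  set d := h x - gaussMean ψ h
  have hEpos : 0 < E := exp_pos _
  have hp : 0 < 1 + a * x ^ 2 := by positivity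
  -- `E * M` is the Mills ratio at `x`
  have hR : x / (1 + a * x ^ 2) ≤ E * M := by
    have := mul_le_mul_of_nonneg_left hmills hEpos.le
    rwa [mul_left_comm, hE, mul_one] at this
  have hJ : |E * J| ≤ C * (1 / a - x * (E * M)) := by
    rw [abs_mul, abs_of_pos hEpos]
    calc E * |J| ≤ _ := mul_le_mul_of_nonneg_left hbound hEpos.le
      _ = C * ((E * exp (-(a * x ^ 2 / 2))) / a - x * (E * M)) := by ring
      _ = _ := by rw [hE]
  have hq : 1 - a * x * (E * M) ≤ 1 / (1 + a * x ^ 2) := by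
    have h1 := mul_le_mul_of_nonneg_left hR (mul_nonneg ha.le hx)
    have h2 : 1 / (1 + a * x ^ 2) = 1 - a * x * (x / (1 + a * x ^ 2)) := by
      field_simp
      ring
    linarith
  have hJ' : a * x ^ 2 * |E * J| ≤ C * x ^ 2 * (1 - a * x * (E * M)) := by
    have h1 := mul_le_mul_of_nonneg_left hJ (show 0 ≤ a * x ^ 2 by positivity)
    have h2 : a * x ^ 2 * (C * (1 / a - x * (E * M))) = C * x ^ 2 * (1 - a * x * (E * M)) := by
      field_simp
    linarith
  have hq1 : 0 ≤ 1 - a * x * (E * M) := by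
    have h1 := mul_le_mul_of_nonneg_left hupper (mul_pos hEpos ha).le
    have h2 : E * a * (exp (-(a * x ^ 2 / 2)) / a) = 1 := by
      rw [← hE]
      field_simp
    linarith
  calc |x * (a * x * (-E * (J + d * M)) + d)|
      = |x * d * (1 - a * x * (E * M)) - a * x ^ 2 * (E * J)| := by ring_nf
    _ ≤ |x * d * (1 - a * x * (E * M))| + |a * x ^ 2 * (E * J)| := abs_sub _ _
    _ = x * |d| * (1 - a * x * (E * M)) + a * x ^ 2 * |E * J| := by
      rw [abs_mul, abs_mul, abs_of_nonneg hx, abs_of_nonneg hq1, abs_mul (a * x ^ 2),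
        abs_of_nonneg (show 0 ≤ a * x ^ 2 by positivity)]
    _ ≤ C * (x ^ 2 + 1 / (2 * a)) * (1 - a * x * (E * M))
        + C * x ^ 2 * (1 - a * x * (E * M)) := by gcongr
    _ = C * (2 * x ^ 2 + 1 / (2 * a)) * (1 - a * x * (E * M)) := by ring
    _ ≤ C * (2 * x ^ 2 + 1 / (2 * a)) * (1 / (1 + a * x ^ 2)) := by gcongr
    _ ≤ 3 / a * C := by
      rw [mul_assoc, mul_comm (3 / a)]
      refine mul_le_mul_of_nonneg_left ?_ hC
      rw [mul_one_div, div_le_div_iff₀ hp ha]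
      field_simp
      nlinarith [sq_nonneg x]

end Stein

theorem stmt15 (ψ : ℝ) (hψ0 : 0 ≤ ψ) (hψ1 : ψ < 1) (h : ℝ → ℝ) (hdiff : Differentiable ℝ h) (C : ℝ) (hC : ∀ x, |deriv h x| ≤ C) :
    ∀ x : ℝ, |x * deriv (steinSol ψ h) x| ≤ 3 / (1 - ψ) * C := by
  intro x
  have hlip := abs_sub_le_of_abs_deriv_le hdiff hC
  have hC0 : 0 ≤ C := (abs_nonneg _).trans (hC 0)
  have hcont := hdiff.continuous
  rcases le_total 0 x with hx | hx
  · exact abs_mul_deriv_steinSol_le hψ1 hC0 hcont hlip hx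
  · have hlip' (s t : ℝ) : |h (-t) - h (-s)| ≤ C * |t - s| := by
      convert! hlip (-s) (-t) using 2
      rw [neg_sub_neg, abs_sub_comm]
    have key := abs_mul_deriv_steinSol_le (h := fun x => h (-x)) hψ1 hC0
      (hcont.comp continuous_neg) hlip' (neg_nonneg.2 hx)
    have heq : steinSol ψ (fun x => h (-x)) = fun u => -steinSol ψ h (-u) :=
      funext (steinSol_comp_neg hψ1 hcont hlip)
    rw [heq, deriv.fun_neg, deriv_comp_neg, neg_neg, neg_neg, neg_mul, abs_neg] at key
    exact key

end
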